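/- Fix Δ > 0 and δ ∈ (0, 2]. There exist constants ρ₀ > 0 and C > 0 (depending only on Δ, δ) such that for all ρ ∈ (0, ρ₀): ∫₀^ρ ∫_ℝ p_r(y)² · exp(Δ|y|^{2−δ}) dy dr ≤ C · ρ^{1/2}. -/

import Mathlib

open MeasureTheory Real

/-- The standard heat kernel `p_t(x) = (2πt)^{-1/2} exp(-x²/(2t))`. -/
noncomputable def heatKernel (t x : ℝ) : ℝ :=
  (2 * Real.pi * t) ^ (-(1:ℝ)/2) * Real.exp (-x ^ 2 / (2 * t))

lemma heatKernel_sq {r : ℝ} (hr : 0 < r) (y : ℝ) :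
    heatKernel r y ^ 2 = (2 * π * r)⁻¹ * rexp (-y ^ 2 / r) := by
  have h : 0 ≤ 2 * π * r := by positivity
  rw [heatKernel, mul_pow, ← Real.rpow_mul_natCast h, ← Real.exp_nat_mul]
  congr 1
  · rw [← Real.rpow_neg_one]
    norm_num
  · congr 1
    push_cast
    field_simp

lemma abs_rpow_le_one_add_sq {a : ℝ} (ha : 0 ≤ a) (ha' : a ≤ 2) (y : ℝ) :
    |y| ^ a ≤ 1 + y ^ 2 := by
  rcases le_total |y| 1 with h | h
  · nlinarith [Real.rpow_le_one (abs_nonneg y) h ha, sq_nonneg y]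
  · have := Real.rpow_le_rpow_of_exponent_le h ha'
    rw [Real.rpow_two, sq_abs] at this
    linarith

lemma heatKernel_sq_mul_exp_le {Δ a r : ℝ} (hΔ : 0 ≤ Δ) (ha : 0 ≤ a) (ha' : a ≤ 2)
    (hr : 0 < r) (hrΔ : 2 * Δ * r ≤ 1) (y : ℝ) :
    heatKernel r y ^ 2 * rexp (Δ * |y| ^ a) ≤
      rexp Δ * (2 * π * r)⁻¹ * rexp (-(2 * r)⁻¹ * y ^ 2) := by
  rw [heatKernel_sq hr, mul_comm (rexp Δ), mul_assoc _ (rexp _), mul_assoc _ (rexp _),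
    ← Real.exp_add, ← Real.exp_add]
  refine mul_le_mul_of_nonneg_left (Real.exp_le_exp.2 ?_) (by positivity)
  have h1 : Δ * |y| ^ a ≤ Δ * (1 + y ^ 2) := by
    gcongr
    exact abs_rpow_le_one_add_sq ha ha' y
  have h2 : Δ ≤ (2 * r)⁻¹ := by
    rw [← one_div, le_div_iff₀ (by positivity)]
    linarith
  have h3 : -y ^ 2 / r = -(2 * r)⁻¹ * y ^ 2 - (2 * r)⁻¹ * y ^ 2 := by
    field_simp
    ring
  nlinarith [mul_le_mul_of_nonneg_right h2 (sq_nonneg y)]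

lemma integral_heatKernel_sq_mul_exp_le {Δ a r : ℝ} (hΔ : 0 ≤ Δ) (ha : 0 ≤ a) (ha' : a ≤ 2)
    (hr : 0 < r) (hrΔ : 2 * Δ * r ≤ 1) :
    ∫ y : ℝ, heatKernel r y ^ 2 * rexp (Δ * |y| ^ a) ≤
      rexp Δ * (2 * π) ^ (-(1 / 2) : ℝ) * r ^ (-(1 / 2) : ℝ) := by
  calc ∫ y : ℝ, heatKernel r y ^ 2 * rexp (Δ * |y| ^ a)
      ≤ ∫ y : ℝ, rexp Δ * (2 * π * r)⁻¹ * rexp (-(2 * r)⁻¹ * y ^ 2) :=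
        integral_mono_of_nonneg (.of_forall fun y ↦ by positivity)
          ((integrable_exp_neg_mul_sq (by positivity)).const_mul _)
          (.of_forall (heatKernel_sq_mul_exp_le hΔ ha ha' hr hrΔ))
    _ = rexp Δ * (2 * π) ^ (-(1 / 2) : ℝ) * r ^ (-(1 / 2) : ℝ) := by
        have h : π / (2 * r)⁻¹ = 2 * π * r := by
          field_simp
        rw [integral_const_mul, integral_gaussian, h, mul_assoc (rexp Δ), mul_assoc (rexp Δ),
          ← Real.mul_rpow (by positivity) hr.le, Real.sqrt_eq_rpow, ← Real.rpow_neg_one,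
          ← Real.rpow_add (by positivity)]
        norm_num

theorem heat_kernel_exp_weight_estimate
    (Δ δ : ℝ) (hΔ : 0 < Δ) (hδ : δ ∈ Set.Ioc (0:ℝ) 2) :
    ∃ ρ₀ > (0:ℝ), ∃ C > (0:ℝ), ∀ ρ ∈ Set.Ioo (0:ℝ) ρ₀,
      (∫ r in Set.Ioo (0:ℝ) ρ, ∫ y : ℝ,
        (heatKernel r y) ^ 2 * Real.exp (Δ * |y| ^ (2 - δ)))
        ≤ C * ρ ^ ((1:ℝ)/2) := by
  have hint (ρ : ℝ) (hρ : 0 < ρ) :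
      IntegrableOn (fun r : ℝ ↦ r ^ (-(1 / 2) : ℝ)) (Set.Ioc 0 ρ) :=
    (intervalIntegrable_iff_integrableOn_Ioc_of_le hρ.le).1
      (intervalIntegral.intervalIntegrable_rpow' (by norm_num))
  refine ⟨(2 * Δ)⁻¹, by positivity, rexp Δ * (2 * π) ^ (-(1 / 2) : ℝ) * 2, by positivity, ?_⟩
  rintro ρ ⟨hρ, hρ'⟩
  calc ∫ r in Set.Ioo (0:ℝ) ρ, ∫ y : ℝ, heatKernel r y ^ 2 * rexp (Δ * |y| ^ (2 - δ))
      ≤ ∫ r in Set.Ioo (0:ℝ) ρ, rexp Δ * (2 * π) ^ (-(1 / 2) : ℝ) * r ^ (-(1 / 2) : ℝ) := by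
        refine integral_mono_of_nonneg
          (.of_forall fun r ↦ integral_nonneg fun y ↦ by positivity)
          (((hint ρ hρ).mono_set Set.Ioo_subset_Ioc_self).const_mul _)
          (ae_restrict_of_forall_mem measurableSet_Ioo fun r hr ↦ ?_)
        refine integral_heatKernel_sq_mul_exp_le hΔ.le (by linarith [hδ.2]) (by linarith [hδ.1])
          hr.1 ?_
        have := hr.2.trans hρ'
        rw [← one_div, lt_div_iff₀ (by positivity)] at this
        linarith
    _ = rexp Δ * (2 * π) ^ (-(1 / 2) : ℝ) * 2 * ρ ^ ((1:ℝ) / 2) := by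
        rw [integral_const_mul, ← integral_Ioc_eq_integral_Ioo,
          ← intervalIntegral.integral_of_le hρ.le, integral_rpow (Or.inl (by norm_num))]
        norm_num
        ring
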